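/- Let φ : ℝ → ℝ be a bounded continuous odd function with lim_{x→+∞} φ(x) = φ(+∞), and J(ρ) = (1/(2πρ))∫_0^{2π} φ(ρ sin ξ) sin ξ dξ. Define η(ρ) = J(ρ) - (2/π)φ(+∞) ρ^{-1}. Then η(ρ) = o(ρ^{-1}) as ρ → +∞, i.e. lim_{ρ→+∞} ρ η(ρ) = 0. -/

import Mathlib

open Real in
theorem integral_abs_sin_zero_two_pi : ∫ ξ in (0 : ℝ)..(2 * π), |Real.sin ξ| = 4 := by
  have hi : ∀ a b : ℝ, IntervalIntegrable (fun ξ => |Real.sin ξ|) MeasureTheory.volume a b :=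
    fun a b => Real.continuous_sin.abs.intervalIntegrable a b
  have h₁ : ∫ ξ in (0 : ℝ)..π, |Real.sin ξ| = 2 := by
    have h : ∫ ξ in (0 : ℝ)..π, Real.sin ξ = 2 := by
      rw [integral_sin, cos_zero, cos_pi]
      norm_num
    rw [← h]
    refine intervalIntegral.integral_congr fun ξ hξ => ?_
    rw [Set.uIcc_of_le pi_pos.le] at hξ
    exact abs_of_nonneg (sin_nonneg_of_mem_Icc hξ)
  have h₂ : ∫ ξ in π..(2 * π), |Real.sin ξ| = 2 := by
    have h := intervalIntegral.integral_comp_add_right (a := 0) (b := π)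
      (fun ξ => |Real.sin ξ|) π
    simp only [sin_add_pi, abs_neg, zero_add, ← two_mul] at h
    rw [← h, h₁]
  rw [← intervalIntegral.integral_add_adjacent_intervals (hi 0 π) (hi π (2 * π)), h₁, h₂]
  norm_num

open Filter in
theorem tendsto_odd_comp_mul_mul_abs {φ : ℝ → ℝ} (hodd : ∀ x : ℝ, φ (-x) = -φ x) {l : ℝ}
    (hlim : Tendsto φ atTop (nhds l)) (s : ℝ) :
    Tendsto (fun ρ : ℝ => φ (ρ * s) * s) atTop (nhds (l * |s|)) := by
  have hpos : ∀ t : ℝ, 0 < t → Tendsto (fun ρ : ℝ => φ (ρ * t) * t) atTop (nhds (l * t)) :=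
    fun t ht => (hlim.comp (tendsto_id.atTop_mul_const ht)).mul_const t
  rcases lt_trichotomy s 0 with hs | rfl | hs
  · rw [abs_of_neg hs]
    refine (hpos (-s) (neg_pos.mpr hs)).congr fun ρ => ?_
    rw [mul_neg ρ, hodd, neg_mul_neg]
  · simp
  · rw [abs_of_pos hs]
    exact hpos s hs


open Filter Real in
theorem stmt_11 (φ : ℝ → ℝ) (hcont : Continuous φ)
    (hbdd : ∃ C : ℝ, ∀ x : ℝ, |φ x| ≤ C)
    (hodd : ∀ x : ℝ, φ (-x) = -φ x)
    (φinf : ℝ) (hlim : Tendsto φ atTop (nhds φinf))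
    (J η : ℝ → ℝ)
    (hJ : ∀ ρ : ℝ, 0 < ρ →
      J ρ = (1 / (2 * π * ρ)) * ∫ ξ in (0:ℝ)..(2 * π), φ (ρ * Real.sin ξ) * Real.sin ξ)
    (hη : ∀ ρ : ℝ, 0 < ρ → η ρ = J ρ - (2 / π) * φinf * ρ⁻¹) :
    Tendsto (fun ρ : ℝ => ρ * η ρ) atTop (nhds 0) := by
  obtain ⟨C, hC⟩ := hbdd
  have hI : Tendsto (fun ρ : ℝ => ∫ ξ in (0:ℝ)..(2 * π), φ (ρ * Real.sin ξ) * Real.sin ξ) atTop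
      (nhds (∫ ξ in (0:ℝ)..(2 * π), φinf * |Real.sin ξ|)) := by
    refine intervalIntegral.tendsto_integral_filter_of_dominated_convergence (fun _ => C)
      (Eventually.of_forall fun ρ => ?_)
      (Eventually.of_forall fun ρ => Eventually.of_forall fun ξ _ => ?_)
      intervalIntegrable_const
      (Eventually.of_forall fun ξ _ => tendsto_odd_comp_mul_mul_abs hodd hlim (Real.sin ξ))
    · exact Continuous.aestronglyMeasurable (by fun_prop)
    · rw [norm_mul, Real.norm_eq_abs, Real.norm_eq_abs]
      exact (mul_le_of_le_one_right (abs_nonneg _) (abs_sin_le_one ξ)).trans (hC _)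
  rw [intervalIntegral.integral_const_mul, integral_abs_sin_zero_two_pi] at hI
  have hzero : 1 / (2 * π) * (φinf * 4) - 2 / π * φinf = 0 := by
    field_simp
    ring
  rw [← hzero]
  refine ((hI.const_mul (1 / (2 * π))).sub_const (2 / π * φinf)).congr' ?_
  filter_upwards [eventually_gt_atTop 0] with ρ hρ
  rw [hη ρ hρ, hJ ρ hρ]
  field_simp
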